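/- Let X be a tree, g₁, g₂ hyperbolic automorphisms with translation lengths m₁ > m₂, axes overlapping along [v⁻, v⁺] with length l > m₂, both translating from v⁻ toward v⁺. Then g₁g₂⁻¹ is hyperbolic with translation length m₁ − m₂, and v⁺ lies on the axis of g₁g₂⁻¹. -/

import Mathlib

theorem aux_step {V : Type*} {G : SimpleGraph V} (hT : G.IsTree) (x y : V) (h : x ≠ y) :
    ∃ a, G.Adj x a ∧ G.dist x y = G.dist a y + 1 := by
  obtain ⟨p, hp⟩ := hT.connected.exists_walk_length_eq_dist x y
  cases p with
  | nil => exact absurd rfl h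
  | cons hadj q =>
    rename_i a
    refine ⟨a, hadj, ?_⟩
    have h1 := SimpleGraph.dist_le q
    have h2 := hT.connected.dist_triangle (u := x) (v := a) (w := y)
    have h3 := SimpleGraph.dist_eq_one_iff_adj.2 hadj
    simp only [SimpleGraph.Walk.length_cons] at hp
    omega

theorem aux_unique {V : Type*} {G : SimpleGraph V} (hT : G.IsTree) (x y a b : V)
    (ha : G.Adj x a) (hb : G.Adj x b) (hay : G.dist x y = G.dist a y + 1)
    (hby : G.dist x y = G.dist b y + 1) : a = b := by
  obtain ⟨p, hp⟩ := hT.connected.exists_walk_length_eq_dist a y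
  obtain ⟨q, hq⟩ := hT.connected.exists_walk_length_eq_dist b y
  have h1 : (SimpleGraph.Walk.cons ha p).IsPath :=
    SimpleGraph.Walk.isPath_of_length_eq_dist _ (by simp [hp, hay])
  have h2 : (SimpleGraph.Walk.cons hb q).IsPath :=
    SimpleGraph.Walk.isPath_of_length_eq_dist _ (by simp [hq, hby])
  have h3 := (hT.existsUnique_path x y).unique h1 h2
  simp only [SimpleGraph.Walk.cons.injEq] at h3
  exact h3.1

theorem aux_branch {V : Type*} {G : SimpleGraph V} (hT : G.IsTree) (y w : V) (n : ℕ) :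
    ∀ x, G.dist x w = n →
    (∀ a, G.Adj x a → G.dist x y = G.dist a y + 1 → G.dist x w = G.dist a w + 1 → False) →
    G.dist y w = G.dist x y + G.dist x w := by
  induction n with
  | zero =>
    intro x hx _
    have := hT.connected.dist_eq_zero_iff.1 hx
    subst this
    simp [SimpleGraph.dist_comm]
  | succ n ih =>
    intro x hx hno
    have hne : x ≠ w := by rintro rfl; simp at hx
    obtain ⟨a, ha, haw⟩ := aux_step hT x w hne
    have h1 := hT.dist_eq_dist_add_one_of_adj y ha
    rw [SimpleGraph.dist_comm (u := y) (v := x), SimpleGraph.dist_comm (u := y) (v := a)] at h1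
    have h2 : G.dist a y = G.dist x y + 1 := by
      rcases h1 with h1 | h1
      · exact (hno a ha h1 haw).elim
      · exact h1
    have h3 := ih a (by omega) (by
      intro b hb hby hbw
      have := aux_unique hT a y b x hb ha.symm hby h2
      subst this
      omega)
    omega

theorem aux_four {V : Type*} {G : SimpleGraph V} (hT : G.IsTree) (y z w : V) (n : ℕ) :
    ∀ x, G.dist x y = n →
    G.dist x y + G.dist z w ≤ max (G.dist x z + G.dist y w) (G.dist x w + G.dist y z) := by
  induction n with
  | zero =>
    intro x hx
    have := hT.connected.dist_eq_zero_iff.1 hx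
    subst this
    have h := hT.connected.dist_triangle (u := z) (v := x) (w := w)
    have := G.dist_comm (u := z) (v := x)
    omega
  | succ n ih =>
    intro x hx
    have t := hT.connected.dist_triangle (u := z) (v := x) (w := w)
    have t' := G.dist_comm (u := z) (v := x)
    by_cases h1 : G.dist y z = G.dist x y + G.dist x z
    · omega
    by_cases h2 : G.dist y w = G.dist x y + G.dist x w
    · omega
    have h1' := mt (aux_branch hT y z _ x rfl) h1
    have h2' := mt (aux_branch hT y w _ x rfl) h2
    push Not at h1' h2'
    obtain ⟨a, ha, hay, haz, -⟩ := h1'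
    obtain ⟨b, hb, hby, hbw, -⟩ := h2'
    have := aux_unique hT x y a b ha hb hay hby
    subst this
    have := ih a (by omega)
    omega

theorem aux_point {V : Type*} {G : SimpleGraph V} (hT : G.IsTree) (y : V) (k : ℕ) :
    ∀ x, k ≤ G.dist x y → ∃ s, G.dist x s + k = G.dist x y ∧ G.dist s y = k := by
  suffices H : ∀ n x, G.dist x y = n + k →
      ∃ s, G.dist x s + k = G.dist x y ∧ G.dist s y = k from
    fun x hx => H (G.dist x y - k) x (by omega)
  intro n
  induction n with
  | zero => intro x hx; exact ⟨x, by simp; omega, by omega⟩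
  | succ n ih =>
    intro x hx
    have hne : x ≠ y := by
      rintro rfl
      rw [SimpleGraph.dist_self] at hx
      omega
    obtain ⟨a, ha, hay⟩ := aux_step hT x y hne
    obtain ⟨s, h1, h2⟩ := ih a (by omega)
    refine ⟨s, ?_, h2⟩
    have t1 := hT.connected.dist_triangle (u := x) (v := a) (w := s)
    have t2 := hT.connected.dist_triangle (u := x) (v := s) (w := y)
    have t3 := SimpleGraph.dist_eq_one_iff_adj.2 ha
    omega

theorem aux_le {V : Type*} {G : SimpleGraph V} (hT : G.IsTree) (g : Equiv.Perm V)
    (hg : ∀ v w, G.Adj (g v) (g w) ↔ G.Adj v w) (x y : V) :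
    G.dist (g x) (g y) ≤ G.dist x y := by
  obtain ⟨p, hp⟩ := hT.connected.exists_walk_length_eq_dist x y
  let f : G →g G := ⟨g, fun h => (hg _ _).2 h⟩
  have := SimpleGraph.dist_le (p.map f)
  rw [SimpleGraph.Walk.length_map, hp] at this
  exact this

theorem aux_iso {V : Type*} {G : SimpleGraph V} (hT : G.IsTree) (g : Equiv.Perm V)
    (hg : ∀ v w, G.Adj (g v) (g w) ↔ G.Adj v w) (x y : V) :
    G.dist (g x) (g y) = G.dist x y := by
  refine le_antisymm (aux_le hT g hg x y) ?_
  have := aux_le hT g⁻¹ (fun v w => by rw [← hg]; simp) (g x) (g y)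
  simpa using this

theorem aux_hyp {V : Type*} {G : SimpleGraph V} (hT : G.IsTree) (g : Equiv.Perm V)
    (hg : ∀ x y, G.dist (g x) (g y) = G.dist x y) (p q : V) (D : ℕ) (hq : g q = p)
    (h1 : G.dist p (g p) = D) (h2 : G.dist q (g p) = 2 * D) (w : V) :
    D ≤ G.dist w (g w) := by
  have e1 := hg q p
  have e2 := hg q w
  have e3 := hg w p
  rw [hq] at e1 e2
  have f := aux_four hT p q (g p) _ (g w) rfl
  have t1 := hT.connected.dist_triangle (u := g w) (v := w) (w := q)
  have t2 := hT.connected.dist_triangle (u := w) (v := g w) (w := p)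
  have c1 := G.dist_comm (u := g w) (v := w)
  have c2 := G.dist_comm (u := w) (v := q)
  have c3 := G.dist_comm (u := g w) (v := p)
  have c4 := G.dist_comm (u := q) (v := p)
  omega

/-- If `g₁, g₂` are hyperbolic automorphisms of a tree with
translation lengths `m₁ > m₂`, whose axes overlap along `[v⁻, v⁺]` of length
`l > m₂`, both translating from `v⁻` toward `v⁺`, then `g₁ g₂⁻¹` is hyperbolic
with translation length `m₁ − m₂`, and `v⁺` lies on the axis of `g₁ g₂⁻¹`. -/
theorem stmt_15 {V : Type*} (G : SimpleGraph V) (hT : G.IsTree)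
    (g₁ g₂ : Equiv.Perm V)
    (hg₁ : ∀ v w, G.Adj (g₁ v) (g₁ w) ↔ G.Adj v w)
    (hg₂ : ∀ v w, G.Adj (g₂ v) (g₂ w) ↔ G.Adj v w)
    (hhyp₁ : ∀ v, g₁ v ≠ v) (hhyp₂ : ∀ v, g₂ v ≠ v)
    (m₁ m₂ : ℕ)
    (hm₁ : m₁ = sInf (Set.range fun v => G.dist v (g₁ v)))
    (hm₂ : m₂ = sInf (Set.range fun v => G.dist v (g₂ v)))
    (h12 : m₂ < m₁)
    (vm vp : V) (l : ℕ) (hl : l = G.dist vm vp) (hlm : m₂ < l)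
    -- the segment [v⁻, v⁺] is contained in both axes:
    (hseg : ∀ w, G.dist vm w + G.dist w vp = G.dist vm vp →
      G.dist w (g₁ w) = m₁ ∧ G.dist w (g₂ w) = m₂)
    -- both translate from v⁻ toward v⁺ (gᵢ v⁺ lies beyond v⁺, m_i past it):
    (hdir₁ : G.dist vm (g₁ vp) = G.dist vm vp + m₁)
    (hdir₂ : G.dist vm (g₂ vp) = G.dist vm vp + m₂) :
    (∀ w, (g₁ * g₂⁻¹) w ≠ w) ∧
    sInf (Set.range fun v => G.dist v ((g₁ * g₂⁻¹) v)) = m₁ - m₂ ∧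
    G.dist vp ((g₁ * g₂⁻¹) vp) = m₁ - m₂ := by
  clear hm₁ hm₂
  have tri := fun u v w => hT.connected.dist_triangle (u := u) (v := v) (w := w)
  have com := fun u v => G.dist_comm (u := u) (v := v)
  have four := fun x y z w => aux_four hT y z w _ x rfl
  have i1 := aux_iso hT g₁ hg₁
  have i2 := aux_iso hT g₂ hg₂
  obtain ⟨s, hs1, hs2⟩ := aux_point hT vp m₂ vm (by omega)
  obtain ⟨a1, a2⟩ := hseg s (by omega)
  obtain ⟨b1, b2⟩ := hseg vp (by simp)
  obtain ⟨c1, c2⟩ := hseg vm (by simp)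
  have hs : g₂ s = vp := by
    apply hT.connected.dist_eq_zero_iff.1
    have := four (g₂ s) vp vm (g₂ vp)
    have := tri vm s (g₂ s)
    have := com vm (g₂ s)
    have := com vm vp
    have := i2 s vp
    omega
  have hinv : g₂⁻¹ vp = s := by rw [← hs]; simp
  have hgp : (g₁ * g₂⁻¹) vp = g₁ s := by
    rw [Equiv.Perm.mul_apply, hinv]
  have j1 := i1 s vp
  have k1 : G.dist vm (g₁ s) = l + m₁ - m₂ := by
    have := tri vm s (g₁ s)
    have := tri vm (g₁ s) (g₁ vp)
    omega
  have k2 : G.dist vp (g₁ s) = m₁ - m₂ := by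
    have := four vp (g₁ s) vm (g₁ vp)
    have := tri vm vp (g₁ s)
    have := com vm vp
    have := com vm (g₁ s)
    omega
  obtain ⟨r, hr⟩ := g₁.surjective vp
  have hq : (g₁ * g₂⁻¹) (g₂ r) = vp := by simp [hr]
  have ig : ∀ x y, G.dist ((g₁ * g₂⁻¹) x) ((g₁ * g₂⁻¹) y) = G.dist x y := by
    intro x y
    have h := i2 (g₂⁻¹ x) (g₂⁻¹ y)
    have hx : g₂ (g₂⁻¹ x) = x := by simp
    have hy : g₂ (g₂⁻¹ y) = y := by simp
    rw [hx, hy] at h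
    rw [Equiv.Perm.mul_apply, Equiv.Perm.mul_apply, i1, h]
  have k3 : G.dist (g₂ r) vp = m₁ - m₂ := by
    rw [← ig, hq, hgp, k2]
  have k4 : G.dist (g₂ r) (g₁ s) = 2 * (m₁ - m₂) := by
    have f := four vm (g₁ s) (g₂ r) vp
    have e1 := i2 vm r
    have e2 := i1 vm r
    have e3 := i1 vm vp
    rw [hr] at e2
    have f2 := four vp (g₁ vm) vm (g₁ vp)
    have t1 := tri vm (g₂ vm) (g₂ r)
    have t2 := tri (g₂ r) vp (g₁ s)
    rw [com vp vm, com (g₁ vm) vm, com vp (g₁ vm), e2, e3, b1, c1, hdir₁, ← hl] at f2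
    rw [e1, c2] at t1
    rw [com (g₁ s) vp, com (g₁ s) (g₂ r), k1, k2, k3, ← hl] at f
    rw [k2, k3] at t2
    have n1 : G.dist vm (g₂ r) < l + (m₁ - m₂) := by
      clear f t2
      rcases le_max_iff.1 f2 with h | h <;> omega
    clear f2 t1 hseg hdir₁ hdir₂ e1 e2 e3 b1 b2 c1 c2 a1 a2 j1 hs1 hs2 k1 k2 k3
    rcases le_max_iff.1 f with h | h <;> omega
  have key := aux_hyp hT (g₁ * g₂⁻¹) ig vp (g₂ r) (m₁ - m₂) hq (by rw [hgp, k2])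
    (by rw [hgp, k4])
  refine ⟨?_, ?_, by rw [hgp, k2]⟩
  · intro w hw
    have := key w
    rw [hw, SimpleGraph.dist_self] at this
    omega
  · apply le_antisymm
    · exact Nat.sInf_le ⟨vp, by simp only [hgp, k2]⟩
    · refine le_csInf (Set.range_nonempty_iff_nonempty.2 ⟨vp⟩) ?_
      rintro _ ⟨w, rfl⟩
      exact key w
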